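/- arXiv:1611.00164 — 2 statements merged into one kernel-verified Lean document; each statement's English description precedes it below -/
import Mathlib

section
/- For every α ∈ (0, 2) and every integer k ≥ 1, the integral ∫_0^π (2 sin(ξ/2))^α cos(kξ) dξ is strictly negative; equivalently, the weights w_k^{PER} = −(1/π)∫_0^π (2 sin(ξ/2))^α cos(kξ) dξ of the scheme with symbol (2 − 2cos ξ)^{α/2} are strictly positive for all k ≠ 0. -/
open Real

theorem continuous_two_mul_sin_half_rpow_mul_cos {α : ℝ} (hα : 0 < α) (k : ℝ) :
    Continuous fun ξ : ℝ => (2 * sin (ξ / 2)) ^ α * cos (k * ξ) :=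
  (Continuous.rpow_const (by fun_prop) fun _ => Or.inr hα.le).mul (by fun_prop)

theorem hasDerivAt_two_mul_sin_half_rpow_mul_cos {α : ℝ} (hα : 0 < α) (k : ℝ) {ξ : ℝ}
    (hξ : ξ ∈ Set.Icc 0 π) :
    HasDerivAt (fun ξ : ℝ => (2 * sin (ξ / 2)) ^ (α + 1) * cos ((k + 1 / 2) * ξ))
      ((k + 1 + α / 2) * ((2 * sin (ξ / 2)) ^ α * cos ((k + 1) * ξ)) -
        (k - α / 2) * ((2 * sin (ξ / 2)) ^ α * cos (k * ξ))) ξ := by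
  have hs : 0 ≤ 2 * sin (ξ / 2) :=
    mul_nonneg zero_le_two
      (sin_nonneg_of_nonneg_of_le_pi (by linarith [hξ.1]) (by linarith [hξ.2, pi_pos]))
  have hsin : HasDerivAt (fun ξ : ℝ => 2 * sin (ξ / 2)) (cos (ξ / 2)) ξ := by
    refine (((hasDerivAt_id' ξ).div_const 2).sin.const_mul 2).congr_deriv ?_
    ring
  have hcos : HasDerivAt (fun ξ : ℝ => cos ((k + 1 / 2) * ξ))
      (-sin ((k + 1 / 2) * ξ) * (k + 1 / 2)) ξ := by
    simpa using ((hasDerivAt_id ξ).const_mul (k + 1 / 2)).cos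
  refine ((hsin.rpow_const (p := α + 1) (Or.inr (by linarith))).mul hcos).congr_deriv ?_
  rw [add_sub_cancel_right, rpow_add_one' hs (by positivity),
    show (k + 1) * ξ = (k + 1 / 2) * ξ + ξ / 2 by ring,
    show k * ξ = (k + 1 / 2) * ξ - ξ / 2 by ring, cos_add, cos_sub]
  ring

theorem integral_two_mul_sin_half_rpow_mul_cos_succ {α : ℝ} (hα : 0 < α) (k : ℕ) :
    (k + 1 + α / 2) * ∫ ξ in (0:ℝ)..π, (2 * sin (ξ / 2)) ^ α * cos ((k + 1 : ℕ) * ξ) =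
      (k - α / 2) * ∫ ξ in (0:ℝ)..π, (2 * sin (ξ / 2)) ^ α * cos (k * ξ) := by
  have hint (c l : ℝ) : IntervalIntegrable
      (fun ξ : ℝ => c * ((2 * sin (ξ / 2)) ^ α * cos (l * ξ))) MeasureTheory.volume 0 π :=
    ((continuous_two_mul_sin_half_rpow_mul_cos hα l).const_mul c).intervalIntegrable _ _
  have hcos : cos ((k + 1 / 2) * π) = 0 :=
    cos_eq_zero_iff.2 ⟨k, by push_cast; ring⟩
  have h := intervalIntegral.integral_eq_sub_of_hasDerivAt
    (fun ξ hξ => hasDerivAt_two_mul_sin_half_rpow_mul_cos hα (k : ℝ)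
      (Set.uIcc_of_le pi_pos.le ▸ hξ)) ((hint _ _).sub (hint _ _))
  rw [intervalIntegral.integral_sub (hint _ _) (hint _ _), intervalIntegral.integral_const_mul,
    intervalIntegral.integral_const_mul, hcos, zero_div, sin_zero, mul_zero, mul_zero,
    zero_rpow (by positivity), zero_mul, sub_zero, sub_eq_zero] at h
  exact_mod_cast h

theorem integral_two_mul_sin_half_rpow_pos {α : ℝ} (hα : 0 < α) :
    0 < ∫ ξ in (0:ℝ)..π, (2 * sin (ξ / 2)) ^ α * cos ((0 : ℕ) * ξ) := by
  refine intervalIntegral.intervalIntegral_pos_of_pos_on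
    ((continuous_two_mul_sin_half_rpow_mul_cos hα _).intervalIntegrable _ _) (fun ξ hξ => ?_)
    pi_pos
  have : 0 < sin (ξ / 2) :=
    sin_pos_of_pos_of_lt_pi (by linarith [hξ.1]) (by linarith [hξ.2, pi_pos])
  simp only [Nat.cast_zero, zero_mul, cos_zero, mul_one]
  positivity

theorem integral_two_mul_sin_half_rpow_mul_cos_neg {α : ℝ} (hα : α ∈ Set.Ioo (0 : ℝ) 2) {k : ℕ}
    (hk : 1 ≤ k) : ∫ ξ in (0:ℝ)..π, (2 * sin (ξ / 2)) ^ α * cos (k * ξ) < 0 := by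
  obtain ⟨h0, h2⟩ := hα
  induction k, hk using Nat.le_induction with
  | base =>
    have h := integral_two_mul_sin_half_rpow_mul_cos_succ h0 0
    refine neg_of_mul_neg_right (h.trans_lt ?_) (by positivity)
    exact mul_neg_of_neg_of_pos (by push_cast; linarith) (integral_two_mul_sin_half_rpow_pos h0)
  | succ k hk ih =>
    have h := integral_two_mul_sin_half_rpow_mul_cos_succ h0 k
    have hk' : (1 : ℝ) ≤ k := by exact_mod_cast hk
    exact neg_of_mul_neg_right (h.trans_lt (mul_neg_of_pos_of_neg (by linarith) ih))
      (by positivity)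

/-- positivity of the weights `w_k^{PER}`.  For `α ∈ (0,2)` and
integer `k ≥ 1`, `∫_0^π (2sin(ξ/2))^α cos(kξ) dξ < 0`; equivalently
`w_k^{PER} = -(1/π)∫_0^π (2sin(ξ/2))^α cos(kξ) dξ > 0`. -/
theorem per_weights_positive
    (α : ℝ) (hα : α ∈ Set.Ioo (0 : ℝ) 2) (k : ℕ) (hk : 1 ≤ k) :
    (∫ ξ in (0:ℝ)..π, (2 * Real.sin (ξ / 2)) ^ α * Real.cos (k * ξ) < 0) ∧
    0 < -(1 / π) * ∫ ξ in (0:ℝ)..π, (2 * Real.sin (ξ / 2)) ^ α * Real.cos (k * ξ) := by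
  have h := integral_two_mul_sin_half_rpow_mul_cos_neg hα hk
  exact ⟨h, mul_pos_of_neg_of_neg (neg_lt_zero.2 (by positivity)) h⟩
end

section
/- For every α ∈ (0, 2), the mean of the symbol (2 sin(ξ/2))^α over [0, π] admits the closed form ∫_0^π (2 sin(ξ/2))^α dξ = 4π·Γ(α) / (α·Γ(α/2)²); equivalently, the central weight of the scheme with symbol (2 − 2cos ξ)^{α/2} is w_0^{PER} = −(1/π)∫_0^π (2 sin(ξ/2))^α dξ = −4Γ(α)/(α·Γ(α/2)²) (times h^{−α} after rescaling). -/
open Real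

/-- Real form of Euler's beta integral. -/
theorem integral_rpow_mul_one_sub_rpow {a b : ℝ} (ha : 0 < a) (hb : 0 < b) :
    ∫ x in (0 : ℝ)..1, x ^ (a - 1) * (1 - x) ^ (b - 1) =
      Real.Gamma a * Real.Gamma b / Real.Gamma (a + b) := by
  have h := Complex.betaIntegral_eq_Gamma_mul_div (a : ℂ) (b : ℂ) (by simpa) (by simpa)
  rw [← Complex.ofReal_add, Complex.Gamma_ofReal, Complex.Gamma_ofReal, Complex.Gamma_ofReal] at h
  have h_int : Complex.betaIntegral a b =
      ((∫ x in (0 : ℝ)..1, x ^ (a - 1) * (1 - x) ^ (b - 1) : ℝ) : ℂ) := by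
    rw [Complex.betaIntegral, ← intervalIntegral.integral_ofReal]
    refine intervalIntegral.integral_congr fun x hx => ?_
    rw [Set.uIcc_of_le zero_le_one] at hx
    simp only [Complex.ofReal_mul, Complex.ofReal_cpow hx.1,
      Complex.ofReal_cpow (sub_nonneg.mpr hx.2), Complex.ofReal_sub, Complex.ofReal_one]
  rw [h_int] at h
  exact_mod_cast h

/-- The substitution `x = sin (ξ / 2) ^ 2` turns the integral of `sin (ξ / 2) ^ α` into a
beta integral. -/
theorem integral_sin_half_rpow_eq (α : ℝ) :
    ∫ ξ in (0 : ℝ)..π, Real.sin (ξ / 2) ^ α =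
      ∫ x in (0 : ℝ)..1, x ^ ((α + 1) / 2 - 1) * (1 - x) ^ ((1 / 2 : ℝ) - 1) := by
  have h_deriv : ∀ ξ : ℝ, HasDerivAt (fun ξ : ℝ => Real.sin (ξ / 2) ^ 2)
      (Real.sin (ξ / 2) * Real.cos (ξ / 2)) ξ := fun ξ => by
    refine ((((hasDerivAt_id ξ).div_const 2).sin).pow 2).congr_deriv ?_
    simp
    ring
  have h_mono : StrictMonoOn (fun ξ : ℝ => Real.sin (ξ / 2) ^ 2) (Set.Icc 0 π) := by
    intro x hx y hy hxy
    have h1 : 0 ≤ Real.sin (x / 2) :=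
      Real.sin_nonneg_of_nonneg_of_le_pi (by linarith [hx.1]) (by linarith [hx.2, Real.pi_pos])
    have h2 : Real.sin (x / 2) < Real.sin (y / 2) :=
      Real.sin_lt_sin_of_lt_of_le_pi_div_two (by linarith [hx.1, Real.pi_pos])
        (by linarith [hy.2]) (by linarith)
    exact pow_lt_pow_left₀ h2 h1 two_ne_zero
  have h_image : (fun ξ : ℝ => Real.sin (ξ / 2) ^ 2) '' Set.Ioo 0 π = Set.Ioo 0 1 := by
    have h_cont : ContinuousOn (fun ξ : ℝ => Real.sin (ξ / 2) ^ 2) (Set.Icc 0 π) := by fun_prop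
    apply Set.Subset.antisymm
    · rintro _ ⟨ξ, hξ, rfl⟩
      have h1 := h_mono (Set.left_mem_Icc.mpr Real.pi_pos.le) (Set.Ioo_subset_Icc_self hξ) hξ.1
      have h2 := h_mono (Set.Ioo_subset_Icc_self hξ) (Set.right_mem_Icc.mpr Real.pi_pos.le) hξ.2
      simp only [zero_div, Real.sin_zero, Real.sin_pi_div_two, one_pow] at h1 h2
      exact ⟨by simpa using h1, h2⟩
    · simpa using intermediate_value_Ioo Real.pi_pos.le h_cont
  rw [intervalIntegral.integral_of_le Real.pi_pos.le, intervalIntegral.integral_of_le zero_le_one,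
    MeasureTheory.integral_Ioc_eq_integral_Ioo, MeasureTheory.integral_Ioc_eq_integral_Ioo,
    ← h_image, MeasureTheory.integral_image_eq_integral_deriv_smul_of_monotoneOn measurableSet_Ioo
      (fun ξ _ => (h_deriv ξ).hasDerivWithinAt)
      (h_mono.monotoneOn.mono Set.Ioo_subset_Icc_self)]
  refine MeasureTheory.setIntegral_congr_fun measurableSet_Ioo fun ξ hξ => ?_
  have hs : 0 < Real.sin (ξ / 2) :=
    Real.sin_pos_of_pos_of_lt_pi (by linarith [hξ.1]) (by linarith [hξ.2, hξ.1])
  have hc : 0 < Real.cos (ξ / 2) :=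
    Real.cos_pos_of_mem_Ioo ⟨by linarith [hξ.1, Real.pi_pos], by linarith [hξ.2]⟩
  have h_cos : (1 - Real.sin (ξ / 2) ^ 2) ^ ((1 / 2 : ℝ) - 1) = (Real.cos (ξ / 2))⁻¹ := by
    rw [← Real.cos_sq', ← Real.rpow_natCast_mul hc.le]
    norm_num [Real.rpow_neg_one]
  have h_sin : (Real.sin (ξ / 2) ^ 2) ^ ((α + 1) / 2 - 1) =
      Real.sin (ξ / 2) ^ α / Real.sin (ξ / 2) := by
    rw [← Real.rpow_natCast_mul hs.le, ← Real.rpow_sub_one hs.ne']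
    congr 1
    push_cast
    ring
  simp only [smul_eq_mul, h_cos, h_sin]
  field_simp

theorem integral_two_mul_sin_half_rpow {α : ℝ} (hα : 0 < α) :
    ∫ ξ in (0 : ℝ)..π, (2 * Real.sin (ξ / 2)) ^ α =
      4 * π * Real.Gamma α / (α * Real.Gamma (α / 2) ^ 2) := by
  have h_scale : ∫ ξ in (0 : ℝ)..π, (2 * Real.sin (ξ / 2)) ^ α =
      2 ^ α * ∫ ξ in (0 : ℝ)..π, Real.sin (ξ / 2) ^ α := by
    rw [← intervalIntegral.integral_const_mul]
    refine intervalIntegral.integral_congr fun ξ hξ => ?_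
    rw [Set.uIcc_of_le Real.pi_pos.le] at hξ
    exact Real.mul_rpow zero_le_two
      (Real.sin_nonneg_of_nonneg_of_le_pi (by linarith [hξ.1]) (by linarith [hξ.2, hξ.1]))
  have h_dup := Real.Gamma_mul_Gamma_add_half (α / 2)
  rw [mul_div_cancel₀ α two_ne_zero, Real.rpow_sub two_pos, Real.rpow_one] at h_dup
  have hΓ : Real.Gamma (α / 2) ≠ 0 := (Real.Gamma_pos_of_pos (half_pos hα)).ne'
  rw [h_scale, integral_sin_half_rpow_eq,
    integral_rpow_mul_one_sub_rpow (by linarith) one_half_pos, Real.Gamma_one_half_eq,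
    show (α + 1) / 2 + 1 / 2 = α / 2 + 1 by ring, Real.Gamma_add_one (half_pos hα).ne',
    show (α + 1) / 2 = α / 2 + 1 / 2 by ring]
  have h_half : Real.Gamma (α / 2 + 1 / 2) =
      Real.Gamma α * (2 / 2 ^ α) * √π / Real.Gamma (α / 2) := by
    rw [← h_dup, mul_div_cancel_left₀ _ hΓ]
  rw [h_half]
  field_simp
  rw [Real.sq_sqrt Real.pi_pos.le]
  ring

/-- closed form of the mean of the symbol `(2sin(ξ/2))^α` over
`[0,π]`: `∫_0^π (2sin(ξ/2))^α dξ = 4π·Γ(α)/(α·Γ(α/2)²)`; equivalently the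
central weight is `w_0^{PER} = -(1/π)∫_0^π (2sin(ξ/2))^α dξ = -4Γ(α)/(α·Γ(α/2)²)`. -/
theorem per_central_weight_closed_form
    (α : ℝ) (hα : α ∈ Set.Ioo (0 : ℝ) 2) :
    (∫ ξ in (0:ℝ)..π, (2 * Real.sin (ξ / 2)) ^ α =
      4 * π * Real.Gamma α / (α * Real.Gamma (α / 2) ^ 2)) ∧
    (-(1 / π) * ∫ ξ in (0:ℝ)..π, (2 * Real.sin (ξ / 2)) ^ α =
      -(4 * Real.Gamma α) / (α * Real.Gamma (α / 2) ^ 2)) := by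
  rw [integral_two_mul_sin_half_rpow hα.1]
  refine ⟨rfl, ?_⟩
  field_simp
end
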